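/- arXiv:1310.6271 — 2 statements merged into one kernel-verified Lean document; each statement's English description precedes it below -/
import Mathlib

section
/- Let L₁ ⊆ L₁⁺ be layers on n channels and let C = L₁ ⨟ N be a sorting network of depth d whose first layer is L₁. Then the network C⁺ = L₁⁺ ⨟ N obtained by replacing the first layer L₁ with the larger layer L₁⁺ is also a sorting network of depth d. In particular, if a sorting network with n channels and depth d exists, then one exists whose first layer is maximal. -/
/-- A comparator on `n` channels: an ordered pair of channel indices
(the first component receives the minimum, the second the maximum). -/
abbrev Comparator (n : ℕ) : Type := Fin n × Fin n

/-- A layer of a comparator network: a list of comparators. -/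
abbrev Layer (n : ℕ) : Type := List (Comparator n)

/-- A comparator network: a list of layers; its depth is the length of this list. -/
abbrev Network (n : ℕ) : Type := List (Layer n)

/-- Two comparators are channel-disjoint if they share no channel. -/
def ChDisjoint {n : ℕ} (c d : Comparator n) : Prop :=
  c.1 ≠ d.1 ∧ c.1 ≠ d.2 ∧ c.2 ≠ d.1 ∧ c.2 ≠ d.2

/-- A valid (ordinary) layer: every comparator `⟨i,j⟩` satisfies `i < j`
and every channel occurs at most once in the layer. -/
def IsLayer {n : ℕ} (L : Layer n) : Prop :=
  (∀ c ∈ L, c.1 < c.2) ∧ L.Pairwise ChDisjoint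

/-- A valid (ordinary) comparator network: all its layers are valid layers. -/
def IsNetwork {n : ℕ} (C : Network n) : Prop := ∀ L ∈ C, IsLayer L

/-- Applying the comparator `c = ⟨i,j⟩` to a vector of values:
channel `i` receives the minimum and channel `j` the maximum of the
values on channels `i` and `j`; all other channels are unchanged. -/
def applyComparator {n : ℕ} {α : Type*} [LinearOrder α] (c : Comparator n)
    (v : Fin n → α) : Fin n → α := fun k =>
  if k = c.1 then min (v c.1) (v c.2)
  else if k = c.2 then max (v c.1) (v c.2)
  else v k

/-- Applying a layer: apply all its comparators (they act on disjoint channels). -/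
def applyLayer {n : ℕ} {α : Type*} [LinearOrder α] (L : Layer n)
    (v : Fin n → α) : Fin n → α :=
  L.foldl (fun w c => applyComparator c w) v

/-- Applying a network: apply its layers in sequence; `applyNetwork C x` is `C(x)`. -/
def applyNetwork {n : ℕ} {α : Type*} [LinearOrder α] (C : Network n)
    (v : Fin n → α) : Fin n → α :=
  C.foldl (fun w L => applyLayer L w) v

/-- `C` sorts every Boolean input: `C(x)` is sorted ascendingly for all `x ∈ {0,1}ⁿ`. -/
def Sorts {n : ℕ} (C : Network n) : Prop :=
  ∀ x : Fin n → Bool, Monotone (applyNetwork C x)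

/-- A sorting network: a valid comparator network sorting every Boolean input. -/
def IsSortingNetwork {n : ℕ} (C : Network n) : Prop := IsNetwork C ∧ Sorts C

/-- A maximal layer: a valid layer into which no further comparator fits,
i.e. with exactly `⌊n/2⌋` comparators. -/
def IsMaximalLayer {n : ℕ} (L : Layer n) : Prop :=
  IsLayer L ∧ L.length = n / 2

theorem applyComparator_eq_self {n : ℕ} {α : Type*} [LinearOrder α] {c : Comparator n}
    {v : Fin n → α} (h : v c.1 ≤ v c.2) : applyComparator c v = v := by
  funext k
  unfold applyComparator
  split_ifs with h₁ h₂
  · rw [h₁, min_eq_left h]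
  · rw [h₂, max_eq_right h]
  · rfl

theorem applyComparator_fst_le_snd {n : ℕ} {α : Type*} [LinearOrder α] {c : Comparator n}
    (h : c.1 < c.2) (v : Fin n → α) :
    applyComparator c v c.1 ≤ applyComparator c v c.2 := by
  simp [applyComparator, h.ne']

theorem applyLayer_eq_self {n : ℕ} {α : Type*} [LinearOrder α] {L : Layer n}
    {v : Fin n → α} (h : ∀ c ∈ L, v c.1 ≤ v c.2) : applyLayer L v = v := by
  induction L with
  | nil => rfl
  | cons c L ih =>
    have hc := applyComparator_eq_self (h c List.mem_cons_self)
    have hL := ih fun d hd => h d (List.mem_cons_of_mem c hd)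
    simpa [applyLayer, hc] using hL

theorem applyLayer_apply_of_notMem {n : ℕ} {α : Type*} [LinearOrder α] {L : Layer n}
    {k : Fin n} (h : ∀ c ∈ L, k ≠ c.1 ∧ k ≠ c.2) (v : Fin n → α) :
    applyLayer L v k = v k := by
  induction L generalizing v with
  | nil => rfl
  | cons c L ih =>
    have hL := ih (fun d hd => h d (List.mem_cons_of_mem c hd)) (applyComparator c v)
    have hc := h c List.mem_cons_self
    change applyLayer L (applyComparator c v) k = v k
    rw [hL]
    simp [applyComparator, hc.1, hc.2]

theorem IsLayer.tail {n : ℕ} {c : Comparator n} {L : Layer n} (h : IsLayer (c :: L)) :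
    IsLayer L :=
  ⟨fun d hd => h.1 d (List.mem_cons_of_mem c hd), (List.pairwise_cons.1 h.2).2⟩

theorem IsLayer.applyLayer_fst_le_snd {n : ℕ} {α : Type*} [LinearOrder α] {L : Layer n}
    (hL : IsLayer L) (v : Fin n → α) {c : Comparator n} (hc : c ∈ L) :
    applyLayer L v c.1 ≤ applyLayer L v c.2 := by
  induction L generalizing v with
  | nil => simp at hc
  | cons d L ih =>
    change applyLayer L (applyComparator d v) c.1 ≤ applyLayer L (applyComparator d v) c.2
    rcases List.mem_cons.1 hc with rfl | hc
    · have hdisj := (List.pairwise_cons.1 hL.2).1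
      rw [applyLayer_apply_of_notMem fun e he => ⟨(hdisj e he).1, (hdisj e he).2.1⟩,
        applyLayer_apply_of_notMem fun e he => ⟨(hdisj e he).2.2.1, (hdisj e he).2.2.2⟩]
      exact applyComparator_fst_le_snd (hL.1 c List.mem_cons_self) v
    · exact ih hL.tail _ hc

theorem IsSortingNetwork.of_subset_first {n : ℕ} {L L' : Layer n} {N : Network n}
    (hC : IsSortingNetwork (L :: N)) (hsub : L ⊆ L') (hL' : IsLayer L') :
    IsSortingNetwork (L' :: N) := by
  refine ⟨?_, fun x => ?_⟩
  · rintro K hK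
    rcases List.mem_cons.1 hK with rfl | hK
    · exact hL'
    · exact hC.1 K (List.mem_cons_of_mem L hK)
  · have hfix : applyLayer L (applyLayer L' x) = applyLayer L' x :=
      applyLayer_eq_self fun c hc => hL'.applyLayer_fst_le_snd x (hsub hc)
    have hsort := hC.2 (applyLayer L' x)
    change Monotone (applyNetwork N (applyLayer L (applyLayer L' x))) at hsort
    rwa [hfix] at hsort

/-- The list of channels occurring in a layer. -/
def Layer.channels {n : ℕ} (L : Layer n) : List (Fin n) :=
  L.flatMap fun c => [c.1, c.2]

theorem Layer.length_channels {n : ℕ} (L : Layer n) :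
    (Layer.channels L).length = 2 * L.length := by
  simp [Layer.channels, List.length_flatMap, mul_comm]

theorem IsLayer.nodup_channels {n : ℕ} {L : Layer n} (hL : IsLayer L) :
    (Layer.channels L).Nodup := by
  refine List.nodup_flatMap.2 ⟨fun c hc => by simpa using (hL.1 c hc).ne, ?_⟩
  refine hL.2.imp ?_
  rintro c d ⟨h₁, h₂, h₃, h₄⟩
  simp [Function.onFun, h₁.symm, h₂.symm, h₃.symm, h₄.symm]

theorem IsLayer.two_mul_length_le {n : ℕ} {L : Layer n} (hL : IsLayer L) :
    2 * L.length ≤ n := by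
  simpa [Layer.length_channels] using hL.nodup_channels.length_le_card

theorem IsLayer.exists_cons {n : ℕ} {L : Layer n} (hL : IsLayer L)
    (h : L.length < n / 2) : ∃ c : Comparator n, IsLayer (c :: L) := by
  have hcard : 1 < ((Layer.channels L).toFinsetᶜ).card := by
    have hle := List.toFinset_card_le (Layer.channels L)
    rw [Layer.length_channels] at hle
    rw [Finset.card_compl, Fintype.card_fin]
    omega
  obtain ⟨a, ha, b, hb, hab⟩ := Finset.one_lt_card.1 hcard
  wlog hlt : a < b generalizing a b
  · exact this b hb a ha hab.symm (lt_of_le_of_ne (not_lt.1 hlt) hab.symm)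
  simp only [Layer.channels, Finset.mem_compl, List.mem_toFinset, List.mem_flatMap,
    List.mem_cons, List.not_mem_nil, or_false, not_exists, not_and, not_or] at ha hb
  refine ⟨(a, b), ?_, List.pairwise_cons.2 ⟨fun d hd => ?_, hL.2⟩⟩
  · rintro c hc
    rcases List.mem_cons.1 hc with rfl | hc
    · exact hlt
    · exact hL.1 c hc
  · exact ⟨(ha d hd).1, (ha d hd).2, (hb d hd).1, (hb d hd).2⟩

theorem IsLayer.exists_isMaximalLayer {n : ℕ} {L : Layer n} (hL : IsLayer L) :
    ∃ L' : Layer n, L ⊆ L' ∧ IsMaximalLayer L' := by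
  rcases (show L.length ≤ n / 2 by have := hL.two_mul_length_le; omega).lt_or_eq with h | h
  · obtain ⟨c, hc⟩ := hL.exists_cons h
    obtain ⟨L', hsub, hL'⟩ := hc.exists_isMaximalLayer
    exact ⟨L', fun d hd => hsub (List.mem_cons_of_mem c hd), hL'⟩
  · exact ⟨L, List.Subset.refl L, hL, h⟩
termination_by n / 2 - L.length
decreasing_by simp only [List.length_cons]; omega

/-- enlarging the first layer of a sorting network preserves being
a sorting network (and the depth); in particular, if a sorting network of depth `d ≥ 1`
exists then one exists whose first layer is maximal. -/
theorem statement_6 {n d : ℕ} (L₁ L₁p : Layer n) (N : Network n)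
    (hsub : L₁ ⊆ L₁p) (hLp : IsLayer L₁p)
    (hC : IsSortingNetwork (L₁ :: N)) (hd : (L₁ :: N).length = d) :
    (IsSortingNetwork (L₁p :: N) ∧ (L₁p :: N).length = d) ∧
    (∀ d' : ℕ, 1 ≤ d' →
      (∃ C : Network n, IsSortingNetwork C ∧ C.length = d') →
      ∃ (L : Layer n) (M : Network n), IsMaximalLayer L ∧
        IsSortingNetwork (L :: M) ∧ (L :: M).length = d') := by
  refine ⟨⟨hC.of_subset_first hsub hLp, hd⟩, ?_⟩
  rintro d' hd' ⟨C, hCs, rfl⟩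
  cases C with
  | nil => simp at hd'
  | cons K M =>
    obtain ⟨L, hKL, hL⟩ := (hCs.1 K List.mem_cons_self).exists_isMaximalLayer
    exact ⟨L, M, hL, hCs.of_subset_first hKL hL.1, rfl⟩
end

section
/- Let F_n = { ⟨i, ⌈n/2⌉ + i⟩ : 1 ≤ i ≤ ⌊n/2⌋ } and let L_a, L_b be layers on n channels such that outputs(F_n ⨟ L_b) ⊆ π(outputs(F_n ⨟ L_a)) for some permutation π of the n channels. If there exists a sorting network with n channels and depth d whose first layer is F_n and second layer is L_a, then there exists a sorting network with n channels and depth d whose first layer is F_n and second layer is L_b. -/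
/-- The fixed maximal first layer `F_n = { ⟨i, ⌈n/2⌉ + i⟩ : 1 ≤ i ≤ ⌊n/2⌋ }`
(here written 0-indexed: comparators `⟨i, ⌈n/2⌉ + i⟩` for `0 ≤ i < ⌊n/2⌋`). -/
def Fnet (n : ℕ) : Layer n :=
  (List.finRange n).filterMap (fun i =>
    if h : i.val < n / 2 ∧ (n + 1) / 2 + i.val < n then
      some (i, ⟨(n + 1) / 2 + i.val, h.2⟩)
    else none)

/-- The set of all possible outputs of `C` on Boolean inputs. -/
def outputs {n : ℕ} (C : Network n) : Set (Fin n → Bool) :=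
  Set.range (fun x : Fin n → Bool => applyNetwork C x)

theorem applyNetwork_cons {n : ℕ} {α : Type*} [LinearOrder α] (L : Layer n) (C : Network n)
    (v : Fin n → α) : applyNetwork (L :: C) v = applyNetwork C (applyLayer L v) := rfl

theorem applyComparator_of_monotone {n : ℕ} {α : Type*} [LinearOrder α] {c : Comparator n}
    (hc : c.1 ≤ c.2) {v : Fin n → α} (hv : Monotone v) : applyComparator c v = v := by
  have h := hv hc
  funext k
  unfold applyComparator
  split_ifs with h₁ h₂
  · rw [min_eq_left h, h₁]
  · rw [max_eq_right h, h₂]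
  · rfl

theorem applyLayer_of_monotone {n : ℕ} {α : Type*} [LinearOrder α] {L : Layer n}
    (hL : ∀ c ∈ L, c.1 < c.2) {v : Fin n → α} (hv : Monotone v) : applyLayer L v = v := by
  induction L with
  | nil => rfl
  | cons c L ih =>
    rw [List.forall_mem_cons] at hL
    change applyLayer L (applyComparator c v) = v
    rw [applyComparator_of_monotone hL.1.le hv, ih hL.2]

theorem applyNetwork_of_monotone {n : ℕ} {α : Type*} [LinearOrder α] {C : Network n}
    (hC : IsNetwork C) {v : Fin n → α} (hv : Monotone v) : applyNetwork C v = v := by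
  induction C with
  | nil => rfl
  | cons L C ih =>
    obtain ⟨hL, hC⟩ := List.forall_mem_cons.1 hC
    rw [applyNetwork_cons, applyLayer_of_monotone hL.1 hv, ih hC]

/-- Relabel the channels of a comparator by `σ`, reorienting it so that the minimum goes to the
smaller channel. -/
def relabelComparator {n : ℕ} (σ : Equiv.Perm (Fin n)) (c : Comparator n) : Comparator n :=
  (min (σ c.1) (σ c.2), max (σ c.1) (σ c.2))

theorem IsLayer.map_relabelComparator {n : ℕ} {L : Layer n} (hL : IsLayer L)
    (σ : Equiv.Perm (Fin n)) : IsLayer (L.map (relabelComparator σ)) := by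
  refine ⟨?_, ?_⟩
  · intro d hd
    obtain ⟨c, hc, rfl⟩ := List.mem_map.1 hd
    exact min_lt_max.2 (σ.injective.ne (hL.1 c hc).ne)
  · refine List.pairwise_map.2 (hL.2.imp ?_)
    rintro c d ⟨h₁, h₂, h₃, h₄⟩
    have h₁ := σ.injective.ne h₁
    have h₂ := σ.injective.ne h₂
    have h₃ := σ.injective.ne h₃
    have h₄ := σ.injective.ne h₄
    rcases le_total (σ c.1) (σ c.2) with h | h <;>
      rcases le_total (σ d.1) (σ d.2) with h' | h' <;>
      simp [ChDisjoint, relabelComparator, h, h', h₁, h₂, h₃, h₄]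

/-- A relabelled comparator acts as the original one up to a permutation of the output, which
differs from the relabelling only on the two channels of the comparator. -/
theorem exists_applyComparator_relabelComparator {n : ℕ} {α : Type*} [LinearOrder α]
    {c : Comparator n} (hc : c.1 ≠ c.2) (τ : Equiv.Perm (Fin n)) :
    ∃ ρ : Equiv.Perm (Fin n),
      (∀ k, k ≠ c.1 → k ≠ c.2 → ρ.symm k = τ.symm k) ∧
      ∀ v : Fin n → α, applyComparator (relabelComparator τ.symm c) (v ∘ τ) =
        applyComparator c v ∘ ρ := by
  rcases le_total (τ.symm c.1) (τ.symm c.2) with h | h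
  · refine ⟨τ, fun _ _ _ => rfl, fun v => funext fun k => ?_⟩
    simp [applyComparator, relabelComparator, h, Equiv.eq_symm_apply]
  · refine ⟨τ.trans (Equiv.swap c.1 c.2), fun k h₁ h₂ => ?_, fun v => funext fun k => ?_⟩
    · simp [Equiv.swap_apply_of_ne_of_ne h₁ h₂]
    · simp only [applyComparator, relabelComparator, min_eq_right h, max_eq_left h,
        Equiv.eq_symm_apply, Function.comp_apply, Equiv.apply_symm_apply, Equiv.trans_apply]
      by_cases h₁ : τ k = c.1
      · simp [h₁, hc, hc.symm, max_comm]
      · by_cases h₂ : τ k = c.2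
        · simp [h₂, min_comm]
        · simp [h₁, h₂, Equiv.swap_apply_of_ne_of_ne h₁ h₂]

theorem exists_applyLayer_relabelComparator {n : ℕ} {α : Type*} [LinearOrder α]
    {L : Layer n} (hL : IsLayer L) (τ : Equiv.Perm (Fin n)) :
    ∃ ρ : Equiv.Perm (Fin n), ∀ v : Fin n → α,
      applyLayer (L.map (relabelComparator τ.symm)) (v ∘ τ) = applyLayer L v ∘ ρ := by
  induction L generalizing τ with
  | nil => exact ⟨τ, fun _ => rfl⟩
  | cons c L ih =>
    obtain ⟨hlt, hdisj⟩ := hL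
    rw [List.forall_mem_cons] at hlt
    rw [List.pairwise_cons] at hdisj
    obtain ⟨ρ, hρ, hcρ⟩ := exists_applyComparator_relabelComparator (α := α) hlt.1.ne τ
    obtain ⟨σ, hσ⟩ := ih ⟨hlt.2, hdisj.2⟩ ρ
    have hmap : L.map (relabelComparator τ.symm) = L.map (relabelComparator ρ.symm) := by
      refine List.map_congr_left fun d hd => ?_
      obtain ⟨h₁, h₂, h₃, h₄⟩ := hdisj.1 d hd
      simp only [relabelComparator, hρ d.1 h₁.symm h₃.symm, hρ d.2 h₂.symm h₄.symm]
    refine ⟨σ, fun v => ?_⟩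
    change applyLayer (L.map (relabelComparator τ.symm))
      (applyComparator (relabelComparator τ.symm c) (v ∘ τ)) =
        applyLayer L (applyComparator c v) ∘ σ
    rw [hcρ, hmap, hσ]

/-- Untangling: permuting the input of a network can be absorbed into a network of the same depth
together with a permutation of the output. -/
theorem exists_untangled_network {n : ℕ} {α : Type*} [LinearOrder α]
    {C : Network n} (hC : IsNetwork C) (τ : Equiv.Perm (Fin n)) :
    ∃ C' : Network n, IsNetwork C' ∧ C'.length = C.length ∧
      ∃ ρ : Equiv.Perm (Fin n), ∀ v : Fin n → α,
        applyNetwork C' (v ∘ τ) = applyNetwork C v ∘ ρ := by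
  induction C generalizing τ with
  | nil => exact ⟨[], hC, rfl, τ, fun _ => rfl⟩
  | cons L C ih =>
    obtain ⟨hL, hC⟩ := List.forall_mem_cons.1 hC
    obtain ⟨ρ, hρ⟩ := exists_applyLayer_relabelComparator (α := α) hL τ
    obtain ⟨C', hC', hlen, σ, hσ⟩ := ih hC ρ
    refine ⟨L.map (relabelComparator τ.symm) :: C',
      List.forall_mem_cons.2 ⟨hL.map_relabelComparator _, hC'⟩, by simp [hlen], σ, fun v => ?_⟩
    rw [applyNetwork_cons, applyNetwork_cons, hρ, hσ]

/-- A network that sorts up to a fixed permutation of the output channels sorts. -/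
theorem IsNetwork.sorts_of_monotone_comp_perm {n : ℕ} {C : Network n} (hC : IsNetwork C)
    (ρ : Equiv.Perm (Fin n))
    (h : ∀ x : Fin n → Bool, ∃ w : Fin n → Bool, Monotone w ∧ applyNetwork C x = w ∘ ρ) :
    Sorts C := by
  intro x
  obtain ⟨w, hw, hx⟩ := h x
  obtain ⟨w', hw', hxw⟩ := h w
  rw [applyNetwork_of_monotone hC hw] at hxw
  have hww' : w' ∘ ρ = w' ∘ (1 : Equiv.Perm (Fin n)) :=
    Tuple.unique_monotone (hxw ▸ hw) hw'
  have : w = w' := hxw.trans hww'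
  rw [hx, this, ← hxw]
  exact hw

/-- let `L_a`, `L_b` be layers with
`outputs(F_n ⨟ L_b) ⊆ π(outputs(F_n ⨟ L_a))` for some permutation `π` of the channels.
If a sorting network of depth `d` with first layer `F_n` and second layer `L_a` exists,
then one with first layer `F_n` and second layer `L_b` exists. -/
theorem statement_9 {n d : ℕ} (La Lb : Layer n) (hLa : IsLayer La) (hLb : IsLayer Lb)
    (π : Equiv.Perm (Fin n))
    (hout : outputs [Fnet n, Lb] ⊆
      (fun v : Fin n → Bool => fun i => v (π.symm i)) '' outputs [Fnet n, La])
    (h : ∃ N : Network n, IsSortingNetwork (Fnet n :: La :: N) ∧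
      (Fnet n :: La :: N).length = d) :
    ∃ N : Network n, IsSortingNetwork (Fnet n :: Lb :: N) ∧
      (Fnet n :: Lb :: N).length = d := by
  obtain ⟨N, ⟨hN, hsort⟩, hlen⟩ := h
  obtain ⟨hF, hN⟩ := List.forall_mem_cons.1 hN
  obtain ⟨-, hN⟩ := List.forall_mem_cons.1 hN
  obtain ⟨N', hN', hlen', ρ, hρ⟩ := exists_untangled_network (α := Bool) hN π.symm
  have hnet : IsNetwork (Fnet n :: Lb :: N') :=
    List.forall_mem_cons.2 ⟨hF, List.forall_mem_cons.2 ⟨hLb, hN'⟩⟩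
  refine ⟨N', ⟨hnet, hnet.sorts_of_monotone_comp_perm ρ fun x => ?_⟩, by simpa [hlen'] using hlen⟩
  obtain ⟨_, ⟨y, rfl⟩, hy⟩ := hout ⟨x, rfl⟩
  refine ⟨_, hsort y, ?_⟩
  exact (congrArg (applyNetwork N') hy.symm).trans (hρ _)
end
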